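/- arXiv:1102.1274 — 2 statements merged into one kernel-verified Lean document; each statement's English description precedes it below -/
import Mathlib

section
/- Let A be a real symmetric 3×3 matrix and μ₀ ∈ ℝ³ a constant vector, and define μ(γ) = Aγ + μ₀. Then the function C(M,γ) = (1/2) γ·Aγ + (M + μ₀)·γ is a Casimir of Π_μ, i.e. Π_μ(M,γ)∇C(M,γ) = 0 for all (M,γ) ∈ ℝ³×ℝ³. -/
open Matrix

noncomputable section

/-- ℝ³ as triples of reals. -/
abbrev V3 : Type := Fin 3 → ℝ

/-- The cross product on ℝ³. -/
def cross3 (a b : V3) : V3 :=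
  ![a 1 * b 2 - a 2 * b 1, a 2 * b 0 - a 0 * b 2, a 0 * b 1 - a 1 * b 0]

/-- The hat map: `hat v` is the skew 3×3 matrix with `hat v * u = v × u`. -/
def hat (v : V3) : Matrix (Fin 3) (Fin 3) ℝ :=
  !![0, -(v 2), v 1; v 2, 0, -(v 0); -(v 1), v 0, 0]

/-- The matrix field Π_μ on ℝ⁶ = ℝ³ × ℝ³, in block form
`[[hat (M + μ(M,γ)), hat γ], [hat γ, 0]]`. -/
def Pim (μ : V3 × V3 → V3) (p : V3 × V3) :
    Matrix (Fin 3 ⊕ Fin 3) (Fin 3 ⊕ Fin 3) ℝ :=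
  Matrix.fromBlocks (hat (p.1 + μ p)) (hat p.2) (hat p.2) 0

/-- The coordinate directions of ℝ⁶ = ℝ³ × ℝ³ (coordinates `(M₁,M₂,M₃,γ₁,γ₂,γ₃)`). -/
def dir : Fin 3 ⊕ Fin 3 → V3 × V3
  | Sum.inl i => (Pi.single i 1, 0)
  | Sum.inr i => (0, Pi.single i 1)

/-- Π_μ satisfies the Jacobi identity:
`Σ_l (Π^{li} ∂_l Π^{jk} + Π^{lj} ∂_l Π^{ki} + Π^{lk} ∂_l Π^{ij}) = 0` at every point. -/
def JacobiIdentity (μ : V3 × V3 → V3) : Prop :=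
  ∀ p : V3 × V3, ∀ i j k : Fin 3 ⊕ Fin 3,
    ∑ l : Fin 3 ⊕ Fin 3,
      (Pim μ p l i * fderiv ℝ (fun q => Pim μ q j k) p (dir l)
        + Pim μ p l j * fderiv ℝ (fun q => Pim μ q k i) p (dir l)
        + Pim μ p l k * fderiv ℝ (fun q => Pim μ q i j) p (dir l)) = 0

/-- The full gradient ∇C ∈ ℝ⁶ of a function on ℝ³ × ℝ³. -/
def gradFull (C : V3 × V3 → ℝ) (p : V3 × V3) : Fin 3 ⊕ Fin 3 → ℝ :=
  fun l => fderiv ℝ C p (dir l)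

/-- `C` is a Casimir of Π_μ : `Π_μ(M,γ) ∇C(M,γ) = 0` everywhere. -/
def IsCasimir (μ : V3 × V3 → V3) (C : V3 × V3 → ℝ) : Prop :=
  ∀ p : V3 × V3, Pim μ p *ᵥ gradFull C p = 0

/-- Gradient in the M-variables (γ fixed) of a function on ℝ³ × ℝ³. -/
def gradM (f : V3 × V3 → ℝ) (p : V3 × V3) : V3 :=
  fun i => fderiv ℝ f p (Pi.single i 1, 0)

/-- Gradient in the γ-variables (M fixed) of a function on ℝ³ × ℝ³. -/
def gradG (f : V3 × V3 → ℝ) (p : V3 × V3) : V3 :=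
  fun i => fderiv ℝ f p (0, Pi.single i 1)

/-- Curl in the M-variables (γ fixed) of a vector field on ℝ³ × ℝ³. -/
def curlM (F : V3 × V3 → V3) (p : V3 × V3) : V3 :=
  ![gradM (fun q => F q 2) p 1 - gradM (fun q => F q 1) p 2,
    gradM (fun q => F q 0) p 2 - gradM (fun q => F q 2) p 0,
    gradM (fun q => F q 1) p 0 - gradM (fun q => F q 0) p 1]

/-- Curl in the γ-variables (M fixed) of a vector field on ℝ³ × ℝ³. -/
def curlG (F : V3 × V3 → V3) (p : V3 × V3) : V3 :=
  ![gradG (fun q => F q 2) p 1 - gradG (fun q => F q 1) p 2,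
    gradG (fun q => F q 0) p 2 - gradG (fun q => F q 2) p 0,
    gradG (fun q => F q 1) p 0 - gradG (fun q => F q 0) p 1]

/-- Gradient of a function on ℝ³. -/
def grad3 (f : V3 → ℝ) (γ : V3) : V3 :=
  fun i => fderiv ℝ f γ (Pi.single i 1)

/-- Curl of a vector field on ℝ³. -/
def curl3 (F : V3 → V3) (γ : V3) : V3 :=
  ![grad3 (fun x => F x 2) γ 1 - grad3 (fun x => F x 1) γ 2,
    grad3 (fun x => F x 0) γ 2 - grad3 (fun x => F x 2) γ 0,
    grad3 (fun x => F x 1) γ 0 - grad3 (fun x => F x 0) γ 1]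

/-- Divergence of a vector field on ℝ³. -/
def div3 (F : V3 → V3) (γ : V3) : ℝ :=
  ∑ i : Fin 3, grad3 (fun x => F x i) γ i

/-- For functions of (γ, s) ∈ ℝ³ × ℝ : gradient in γ at fixed s. -/
def gradg (f : V3 × ℝ → ℝ) (q : V3 × ℝ) : V3 :=
  fun i => fderiv ℝ f q (Pi.single i 1, 0)

/-- For vector fields of (γ, s) ∈ ℝ³ × ℝ : curl in γ at fixed s. -/
def curlg (F : V3 × ℝ → V3) (q : V3 × ℝ) : V3 :=
  ![gradg (fun x => F x 2) q 1 - gradg (fun x => F x 1) q 2,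
    gradg (fun x => F x 0) q 2 - gradg (fun x => F x 2) q 0,
    gradg (fun x => F x 1) q 0 - gradg (fun x => F x 0) q 1]

/-- ∂₄: partial derivative with respect to the fourth variable s, for a vector field ν(γ,s). -/
def d4 (F : V3 × ℝ → V3) (q : V3 × ℝ) : V3 :=
  fun k => fderiv ℝ (fun x => F x k) q (0, 1)

/-- ∂₄: partial derivative with respect to the fourth variable s, for a scalar function D(γ,s). -/
def d4s (f : V3 × ℝ → ℝ) (q : V3 × ℝ) : ℝ :=
  fderiv ℝ f q (0, 1)

theorem hat_mulVec (v u : V3) : hat v *ᵥ u = v ⨯₃ u := by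
  ext i
  fin_cases i <;> simp [hat, cross_apply, mulVec, dotProduct, Fin.sum_univ_three] <;> ring

section Calculus

variable {E : Type*} [NormedAddCommGroup E] [NormedSpace ℝ E]
  {m n : Type*} [Fintype m] [Fintype n]

theorem HasFDerivAt.dotProduct {f g : E → n → ℝ} {f' g' : E →L[ℝ] n → ℝ} {x : E}
    (hf : HasFDerivAt f f' x) (hg : HasFDerivAt g g' x) :
    HasFDerivAt (fun y => f y ⬝ᵥ g y)
      (∑ i, (f x i • (ContinuousLinearMap.proj i).comp g'
        + g x i • (ContinuousLinearMap.proj i).comp f')) x :=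
  HasFDerivAt.fun_sum fun i _ => (hasFDerivAt_pi'.1 hf i).mul (hasFDerivAt_pi'.1 hg i)

theorem HasFDerivAt.matrix_mulVec (A : Matrix m n ℝ) {f : E → n → ℝ} {f' : E →L[ℝ] n → ℝ}
    {x : E} (hf : HasFDerivAt f f' x) :
    HasFDerivAt (fun y => A *ᵥ f y) (A.mulVecLin.toContinuousLinearMap.comp f') x :=
  A.mulVecLin.toContinuousLinearMap.hasFDerivAt.comp x hf

end Calculus

/-- The differential of `½ γ·Aγ + (M + μ₀)·γ` for symmetric `A`. -/
theorem fderiv_quadratic_add_dotProduct {A : Matrix (Fin 3) (Fin 3) ℝ} (hA : A = Aᵀ) (μ0 : V3)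
    (p v : V3 × V3) :
    fderiv ℝ (fun p : V3 × V3 => (1 / 2) * (p.2 ⬝ᵥ (A *ᵥ p.2)) + (p.1 + μ0) ⬝ᵥ p.2) p v
      = p.2 ⬝ᵥ v.1 + (p.1 + (A *ᵥ p.2 + μ0)) ⬝ᵥ v.2 := by
  have hM : HasFDerivAt (fun q : V3 × V3 => q.1 + μ0) (ContinuousLinearMap.fst ℝ V3 V3) p :=
    hasFDerivAt_fst.add_const μ0
  have hγ : HasFDerivAt (fun q : V3 × V3 => q.2) (ContinuousLinearMap.snd ℝ V3 V3) p :=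
    hasFDerivAt_snd
  have hsymm : p.2 ⬝ᵥ (A *ᵥ v.2) = (A *ᵥ p.2) ⬝ᵥ v.2 := by
    rw [dotProduct_mulVec, ← mulVec_transpose, ← hA]
  rw [(((hγ.dotProduct (hγ.matrix_mulVec A)).const_mul (1 / 2)).fun_add (hM.dotProduct hγ)).fderiv]
  have h : (1 / 2 : ℝ) * (p.2 ⬝ᵥ (A *ᵥ v.2) + (A *ᵥ p.2) ⬝ᵥ v.2)
      + ((p.1 + μ0) ⬝ᵥ v.2 + p.2 ⬝ᵥ v.1)
      = p.2 ⬝ᵥ v.1 + (p.1 + (A *ᵥ p.2 + μ0)) ⬝ᵥ v.2 := by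
    rw [hsymm]
    simp only [add_dotProduct]
    ring
  rw [← h]
  simp [dotProduct, Finset.sum_add_distrib, mul_add]

/-- For A symmetric and μ(γ) = Aγ + μ₀, C(M,γ) = ½ γ·Aγ + (M + μ₀)·γ is a Casimir of Π_μ. -/
theorem statement13 (A : Matrix (Fin 3) (Fin 3) ℝ) (hA : A = Aᵀ) (μ0 : V3) :
    IsCasimir (fun p => A *ᵥ p.2 + μ0)
      (fun p => (1 / 2) * (p.2 ⬝ᵥ (A *ᵥ p.2)) + (p.1 + μ0) ⬝ᵥ p.2) := by
  intro p
  have hgrad : gradFull (fun p => (1 / 2) * (p.2 ⬝ᵥ (A *ᵥ p.2)) + (p.1 + μ0) ⬝ᵥ p.2) p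
      = Sum.elim p.2 (p.1 + (A *ᵥ p.2 + μ0)) := by
    ext (i | i) <;> rw [gradFull, fderiv_quadratic_add_dotProduct hA] <;> simp [dir]
  rw [hgrad, Pim, fromBlocks_mulVec]
  simp only [Sum.elim_comp_inl, Sum.elim_comp_inr, hat_mulVec, cross_anticomm', cross_self,
    zero_mulVec, add_zero, Sum.elim_zero_zero]
end
end

section
/- Let a : ℝ → ℝ, b : ℝ³×ℝ → ℝ, and φ : ℝ³ → ℝ be smooth, and define ν : ℝ³×ℝ → ℝ³ by ν(γ,s) = a(s)∇_γφ(γ) + b(γ,s)γ. Then ν satisfies the Jacobi condition equation: γ · curl_γ ν(γ,s) + ν(γ,s) · ( γ × ∂₄ν(γ,s) ) = 0 for all (γ,s) ∈ ℝ³×ℝ; consequently, with μ(M,γ) = ν(γ, M·γ), the matrix field Π_μ satisfies the Jacobi identity. -/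
open Matrix

noncomputable section

/-- ν(γ,s) = a(s)∇_γφ(γ) + b(γ,s)γ. -/
def nu16 (a : ℝ → ℝ) (b : V3 × ℝ → ℝ) (φ : V3 → ℝ) (q : V3 × ℝ) : V3 :=
  a q.2 • grad3 φ q.1 + b q • q.1

/-- The derivative of the matrix entries of `Π_μ`, in terms of that of `μ`. -/
lemma fderiv_Pim_apply {μ : V3 × V3 → V3} (hμ : Differentiable ℝ μ) (p v : V3 × V3)
    (j k : Fin 3 ⊕ Fin 3) :
    fderiv ℝ (fun q => Pim μ q j k) p v =
      Matrix.fromBlocks (hat (v.1 + fderiv ℝ μ p v)) (hat v.2) (hat v.2) 0 j k := by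
  have h1 : ∀ i : Fin 3, HasFDerivAt (fun q : V3 × V3 => q.1 i + μ q i)
      ((ContinuousLinearMap.proj i).comp
        (ContinuousLinearMap.fst ℝ V3 V3 + fderiv ℝ μ p)) p := fun i =>
    hasFDerivAt_pi'.1 (hasFDerivAt_fst.add (hμ p).hasFDerivAt) i
  have h2 : ∀ i : Fin 3, HasFDerivAt (fun q : V3 × V3 => q.2 i)
      ((ContinuousLinearMap.proj i).comp (ContinuousLinearMap.snd ℝ V3 V3)) p := fun i =>
    hasFDerivAt_pi'.1 hasFDerivAt_snd i
  rcases j with j | j <;> rcases k with k | k <;> fin_cases j <;> fin_cases k <;>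
    simp [Pim, hat, (h1 _).fderiv, (h2 _).fderiv, (h1 _).fun_neg.fderiv, (h2 _).fun_neg.fderiv,
      -neg_add_rev]

/-- The derivative of `(M, γ) ↦ ν (γ, M · γ)`. -/
lemma fderiv_comp_dotProduct {ν : V3 × ℝ → V3} (hν : Differentiable ℝ ν) (p v : V3 × V3) :
    fderiv ℝ (fun q : V3 × V3 => ν (q.2, q.1 ⬝ᵥ q.2)) p v =
      fderiv ℝ ν (p.2, p.1 ⬝ᵥ p.2) (v.2, v.1 ⬝ᵥ p.2 + p.1 ⬝ᵥ v.2) := by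
  have h1 : ∀ i : Fin 3, HasFDerivAt (fun q : V3 × V3 => q.1 i)
      ((ContinuousLinearMap.proj i).comp (ContinuousLinearMap.fst ℝ V3 V3)) p := fun i =>
    hasFDerivAt_pi'.1 hasFDerivAt_fst i
  have h2 : ∀ i : Fin 3, HasFDerivAt (fun q : V3 × V3 => q.2 i)
      ((ContinuousLinearMap.proj i).comp (ContinuousLinearMap.snd ℝ V3 V3)) p := fun i =>
    hasFDerivAt_pi'.1 hasFDerivAt_snd i
  have hd : HasFDerivAt (fun q : V3 × V3 => q.1 ⬝ᵥ q.2) _ p :=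
    HasFDerivAt.fun_sum fun i (_ : i ∈ Finset.univ) => (h1 i).mul (h2 i)
  have hc := (hν (p.2, p.1 ⬝ᵥ p.2)).hasFDerivAt.comp p (hasFDerivAt_snd.prodMk hd)
  rw [show (fun q : V3 × V3 => ν (q.2, q.1 ⬝ᵥ q.2)) =
    ν ∘ fun q : V3 × V3 => (q.2, q.1 ⬝ᵥ q.2) from rfl, hc.fderiv]
  simp only [ContinuousLinearMap.comp_apply]
  congr 1
  simp [dotProduct, Fin.sum_univ_three]
  ring

lemma fderiv_coord {ν : V3 × ℝ → V3} (hν : Differentiable ℝ ν) (q v : V3 × ℝ) (k : Fin 3) :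
    fderiv ℝ (fun x => ν x k) q v = fderiv ℝ ν q v k := by
  rw [(hasFDerivAt_pi'.1 (hν q).hasFDerivAt k).fderiv]; rfl

lemma d4_eq_fderiv {ν : V3 × ℝ → V3} (hν : Differentiable ℝ ν) (q : V3 × ℝ) :
    d4 ν q = fderiv ℝ ν q (0, 1) :=
  funext fun k => fderiv_coord hν q (0, 1) k

set_option maxHeartbeats 2000000 in
/-- The Jacobi condition equation for `ν` implies the Jacobi identity of `Π_μ` with
`μ (M, γ) = ν (γ, M · γ)`. -/
lemma jacobiIdentity_of_jacobi_condition {ν : V3 × ℝ → V3} (hν : Differentiable ℝ ν)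
    (h : ∀ (γ : V3) (s : ℝ), γ ⬝ᵥ curlg ν (γ, s) + ν (γ, s) ⬝ᵥ cross3 γ (d4 ν (γ, s)) = 0) :
    JacobiIdentity (fun p => ν (p.2, p.1 ⬝ᵥ p.2)) := by
  rintro ⟨M, γ⟩ i j k
  have hμ : Differentiable ℝ fun p : V3 × V3 => ν (p.2, p.1 ⬝ᵥ p.2) := by
    refine hν.comp (differentiable_snd.prodMk ?_)
    unfold dotProduct
    fun_prop
  have hJ := h γ (M ⬝ᵥ γ)
  simp only [fderiv_Pim_apply hμ, fderiv_comp_dotProduct hν]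
  have hsplit : ∀ (u : V3) (t : ℝ), fderiv ℝ ν (γ, M ⬝ᵥ γ) (u, t) =
      fderiv ℝ ν (γ, M ⬝ᵥ γ) (u, 0) + t • fderiv ℝ ν (γ, M ⬝ᵥ γ) (0, 1) := fun u t => by
    rw [← map_smul, ← map_add]; simp
  simp only [curlg, gradg, d4_eq_fderiv hν, fderiv_coord hν] at hJ
  simp only [Fintype.sum_sum_type, Fin.sum_univ_three, dir, Pim, hsplit _ (_ + _)]
  generalize ν (γ, M ⬝ᵥ γ) = n at *
  have hz : fderiv ℝ ν (γ, M ⬝ᵥ γ) (0, 0) = 0 := map_zero _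
  simp only [hz, zero_add]
  generalize fderiv ℝ ν (γ, M ⬝ᵥ γ) (0, 1) = d at *
  generalize fderiv ℝ ν (γ, M ⬝ᵥ γ) (Pi.single 0 1, 0) = e0 at *
  generalize fderiv ℝ ν (γ, M ⬝ᵥ γ) (Pi.single 1 1, 0) = e1 at *
  generalize fderiv ℝ ν (γ, M ⬝ᵥ γ) (Pi.single 2 1, 0) = e2 at *
  simp [cross3, dotProduct, Fin.sum_univ_three] at hJ
  rcases i with i | i <;> rcases j with j | j <;> rcases k with k | k <;>
    fin_cases i <;> fin_cases j <;> fin_cases k <;>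
    simp [hat] <;> first | ring1 | linear_combination hJ | linear_combination -hJ

lemma contDiff_grad3 {φ : V3 → ℝ} (hφ : ContDiff ℝ (⊤ : ℕ∞) φ) :
    ContDiff ℝ (⊤ : ℕ∞) (grad3 φ) :=
  contDiff_pi.2 fun _ => (hφ.fderiv_right le_rfl).clm_apply contDiff_const

lemma fderiv_grad3_symm {φ : V3 → ℝ} (hφ : ContDiff ℝ (⊤ : ℕ∞) φ) (γ : V3) (i j : Fin 3) :
    fderiv ℝ (grad3 φ) γ (Pi.single i 1) j = fderiv ℝ (grad3 φ) γ (Pi.single j 1) i := by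
  have hd : DifferentiableAt ℝ (fderiv ℝ φ) γ :=
    (hφ.fderiv_right (m := (⊤ : ℕ∞)) le_rfl).differentiable (by simp) γ
  have hH : ∀ u : V3, ∀ k, fderiv ℝ (grad3 φ) γ u k =
      fderiv ℝ (fderiv ℝ φ) γ u (Pi.single k 1) := fun u k => by
    have := hasFDerivAt_pi'.1
      (((contDiff_grad3 hφ).differentiable (by simp) γ).hasFDerivAt) k
    have h2 := hd.hasFDerivAt.clm_apply (hasFDerivAt_const (Pi.single k 1 : V3) γ)
    simpa using congrArg (fun L => L u) (this.unique h2)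
  rw [hH, hH]
  exact (hφ.contDiffAt.isSymmSndFDerivAt
    (by simpa using WithTop.coe_le_coe.2 (le_top : (2 : ℕ∞) ≤ ⊤))) _ _

/-- ν = a(s)∇_γφ + b(γ,s)γ satisfies the Jacobi condition equation; consequently Π_μ
with μ(M,γ) = ν(γ, M·γ) satisfies the Jacobi identity. -/
theorem statement16 (a : ℝ → ℝ) (b : V3 × ℝ → ℝ) (φ : V3 → ℝ)
    (ha : ContDiff ℝ (⊤ : ℕ∞) a) (hb : ContDiff ℝ (⊤ : ℕ∞) b)
    (hφ : ContDiff ℝ (⊤ : ℕ∞) φ) :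
    (∀ (γ : V3) (s : ℝ),
      γ ⬝ᵥ curlg (nu16 a b φ) (γ, s) +
        nu16 a b φ (γ, s) ⬝ᵥ cross3 γ (d4 (nu16 a b φ) (γ, s)) = 0) ∧
    JacobiIdentity (fun p => nu16 a b φ (p.2, p.1 ⬝ᵥ p.2)) := by
  have hg : Differentiable ℝ (grad3 φ) := (contDiff_grad3 hφ).differentiable (by simp)
  have ha' : Differentiable ℝ a := ha.differentiable (by simp)
  have hb' : Differentiable ℝ b := hb.differentiable (by simp)
  have hν : Differentiable ℝ (nu16 a b φ) := by
    unfold nu16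
    fun_prop
  have hJ : ∀ (γ : V3) (s : ℝ), γ ⬝ᵥ curlg (nu16 a b φ) (γ, s) +
      nu16 a b φ (γ, s) ⬝ᵥ cross3 γ (d4 (nu16 a b φ) (γ, s)) = 0 := by
    intro γ s
    have hD : ∀ v : V3 × ℝ, fderiv ℝ (nu16 a b φ) (γ, s) v =
        a s • fderiv ℝ (grad3 φ) γ v.1 + (v.2 * deriv a s) • grad3 φ γ +
          (b (γ, s) • v.1 + fderiv ℝ b (γ, s) v • γ) := fun v => by
      have h1 := (ha' s).hasFDerivAt.comp (γ, s)
        (hasFDerivAt_snd (𝕜 := ℝ) (E := V3) (F := ℝ) (p := (γ, s)))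
      have h2 := (hg γ).hasFDerivAt.comp (γ, s)
        (hasFDerivAt_fst (𝕜 := ℝ) (E := V3) (F := ℝ) (p := (γ, s)))
      have h3 := (h1.smul h2).add ((hb' (γ, s)).hasFDerivAt.smul
        (hasFDerivAt_fst (𝕜 := ℝ) (E := V3) (F := ℝ) (p := (γ, s))))
      have h4 : HasFDerivAt (nu16 a b φ) _ (γ, s) := h3
      rw [h4.fderiv]
      simp
    simp only [curlg, gradg, d4_eq_fderiv hν, fderiv_coord hν, hD]
    simp [nu16, cross3, dotProduct, Fin.sum_univ_three, fderiv_grad3_symm hφ γ 1 0,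
      fderiv_grad3_symm hφ γ 2 0, fderiv_grad3_symm hφ γ 2 1]
    ring
  exact ⟨hJ, jacobiIdentity_of_jacobi_condition hν hJ⟩
end
end
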